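/- Let A be the presented group with generators a, b, c and relations abab = baba, bcb = cbc, and ca = ac. Then there is no group homomorphism ρ : A → A with ρ(a) = a, ρ(b) = b, and ρ(c) lying in the subgroup generated by a and b; that is, A admits no retraction onto the standard parabolic subgroup generated by a and b. -/

import Mathlib

/-- Relations of the Artin group of the triangle `(2,3,4)` on generators
`a = 0`, `b = 1`, `c = 2`: `abab = baba`, `bcb = cbc`, `ca = ac`. -/
def triangleRels : Set (FreeGroup (Fin 3)) :=
  { FreeGroup.of 0 * FreeGroup.of 1 * FreeGroup.of 0 * FreeGroup.of 1 *
      (FreeGroup.of 1 * FreeGroup.of 0 * FreeGroup.of 1 * FreeGroup.of 0)⁻¹,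
    FreeGroup.of 1 * FreeGroup.of 2 * FreeGroup.of 1 *
      (FreeGroup.of 2 * FreeGroup.of 1 * FreeGroup.of 2)⁻¹,
    FreeGroup.of 2 * FreeGroup.of 0 * (FreeGroup.of 0 * FreeGroup.of 2)⁻¹ }

/-- Images of `a`, `b`, `c` in the symmetric group on four letters. -/
def permGen : Fin 3 → Equiv.Perm (Fin 4) :=
  ![Equiv.swap 0 3 * Equiv.swap 1 2, Equiv.swap 0 1, Equiv.swap 1 2]

lemma lift_permGen_eq_one : ∀ r ∈ triangleRels, FreeGroup.lift permGen r = 1 := by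
  rintro r (rfl | rfl | rfl) <;> simp only [map_mul, map_inv, FreeGroup.lift_apply_of] <;> decide

/-- The quotient map from the Artin group onto the symmetric group on four letters. -/
def toPerm : PresentedGroup triangleRels →* Equiv.Perm (Fin 4) :=
  PresentedGroup.toGroup lift_permGen_eq_one

lemma toPerm_of (i : Fin 3) : toPerm (PresentedGroup.of i) = permGen i :=
  PresentedGroup.toGroup.of lift_permGen_eq_one

lemma of_one_braid_of_two :
    (PresentedGroup.of 1 * PresentedGroup.of 2 * PresentedGroup.of 1 :
      PresentedGroup triangleRels) =
      PresentedGroup.of 2 * PresentedGroup.of 1 * PresentedGroup.of 2 :=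
  mul_inv_eq_one.mp (PresentedGroup.one_of_mem (rels := triangleRels) (Or.inr (Or.inl rfl)))

lemma of_two_comm_of_zero :
    (PresentedGroup.of 2 * PresentedGroup.of 0 : PresentedGroup triangleRels) =
      PresentedGroup.of 0 * PresentedGroup.of 2 :=
  mul_inv_eq_one.mp (PresentedGroup.one_of_mem (rels := triangleRels) (Or.inr (Or.inr rfl)))

/-- The images of `a` and `b` generate a dihedral group of order eight, whose centre is generated
by the double transposition below. -/
lemma toPerm_mem_centralizer {g : PresentedGroup triangleRels}
    (hg : g ∈ Subgroup.closure {PresentedGroup.of 0, PresentedGroup.of 1}) :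
    toPerm g ∈ Subgroup.centralizer {Equiv.swap (0 : Fin 4) 1 * Equiv.swap 2 3} := by
  suffices h : Subgroup.closure {PresentedGroup.of 0, PresentedGroup.of 1} ≤
      (Subgroup.centralizer {Equiv.swap (0 : Fin 4) 1 * Equiv.swap 2 3}).comap toPerm from h hg
  rw [Subgroup.closure_le]
  rintro _ (rfl | rfl) <;>
    rw [SetLike.mem_coe, Subgroup.mem_comap, toPerm_of, Subgroup.mem_centralizer_singleton_iff] <;>
    decide

lemma not_braid_of_mem_centralizer : ∀ x : Equiv.Perm (Fin 4),
    x * (Equiv.swap 0 1 * Equiv.swap 2 3) = Equiv.swap 0 1 * Equiv.swap 2 3 * x →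
    x * permGen 0 = permGen 0 * x → permGen 1 * x * permGen 1 ≠ x * permGen 1 * x := by
  decide

/-- The Artin group of the triangle `(2,3,4)` admits no retraction onto the standard
parabolic subgroup generated by `a` and `b`. -/
theorem no_retraction_234 :
    ¬ ∃ ρ : PresentedGroup triangleRels →* PresentedGroup triangleRels,
        ρ (PresentedGroup.of 0) = PresentedGroup.of 0 ∧
        ρ (PresentedGroup.of 1) = PresentedGroup.of 1 ∧
        ρ (PresentedGroup.of 2) ∈
          Subgroup.closure {PresentedGroup.of 0, PresentedGroup.of 1} := by
  rintro ⟨ρ, ha, hb, hc⟩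
  have hcomm := congrArg (fun g => toPerm (ρ g)) of_two_comm_of_zero
  have hbraid := congrArg (fun g => toPerm (ρ g)) of_one_braid_of_two
  simp only [map_mul, ha, hb, toPerm_of] at hcomm hbraid
  exact not_braid_of_mem_centralizer _
    (Subgroup.mem_centralizer_singleton_iff.mp (toPerm_mem_centralizer hc)) hcomm hbraid
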